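/- arXiv:2601.11493 — 7 statements merged into one kernel-verified Lean document; each statement's English description precedes it below -/
import Mathlib

section
/- Let A be an m×n complex matrix, Ω an n×s complex matrix, Φ an m×s complex matrix, and suppose both the core matrix H = Φ* A Ω and its leading principal (s−1)×(s−1) submatrix H_{−s,−s} = (Φ_{:,−s})* A Ω_{:,−s} are invertible. Let Â = (A Ω) H⁻¹ (Φ* A) and let Â_{−s,−s} = (A Ω_{:,−s}) (H_{−s,−s})⁻¹ ((Φ_{:,−s})* A) be the generalized Nyström approximation computed with the last columns of Ω and Φ omitted. Then Â_{−s,−s} = Â − (A Ω H⁻¹ eₛ)(eₛ* H⁻¹ Φ* A) / [H⁻¹]_{s,s}, where eₛ is the s-th standard basis vector of ℂ^s. -/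
open Matrix

/-- The inverse of the leading principal submatrix, padded with a zero last row and column, is a
rank-one downdate of the inverse of the full matrix. -/
theorem inv_submatrix_castSucc_padded {K : Type*} [Field K] {s : ℕ}
    (H : Matrix (Fin (s + 1)) (Fin (s + 1)) K) (hH : IsUnit H)
    (hS : IsUnit (H.submatrix Fin.castSucc Fin.castSucc)) :
    (1 : Matrix (Fin (s + 1)) (Fin (s + 1)) K).submatrix id Fin.castSucc *
        (H.submatrix Fin.castSucc Fin.castSucc)⁻¹ *
        (1 : Matrix (Fin (s + 1)) (Fin (s + 1)) K).submatrix Fin.castSucc id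
      = H⁻¹ - (H⁻¹ (Fin.last s) (Fin.last s))⁻¹ •
          vecMulVec (fun i => H⁻¹ i (Fin.last s)) (fun j => H⁻¹ (Fin.last s) j) := by
  set G := (H.submatrix Fin.castSucc Fin.castSucc)⁻¹ with hG
  set E := (1 : Matrix (Fin (s + 1)) (Fin (s + 1)) K).submatrix id Fin.castSucc with hE
  set F := (1 : Matrix (Fin (s + 1)) (Fin (s + 1)) K).submatrix Fin.castSucc id with hF
  have hHdet := (isUnit_iff_isUnit_det H).mp hH
  have hSdet := (isUnit_iff_isUnit_det _).mp hS
  have hFHE : F * H * E = H.submatrix Fin.castSucc Fin.castSucc := by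
    ext i j
    simp [hE, hF, Matrix.mul_apply, Matrix.one_apply]
  have hFHM : F * (H * (E * G * F)) = F := by
    rw [show F * (H * (E * G * F)) = F * H * E * G * F by simp only [Matrix.mul_assoc], hFHE,
      hG, mul_nonsing_inv _ hSdet, Matrix.one_mul]
  have hlast (j) : (E * G * F) (Fin.last s) j = 0 := by
    rw [Matrix.mul_assoc, Matrix.mul_apply]
    exact Finset.sum_eq_zero fun x _ => by
      simp [hE, (Fin.castSucc_lt_last x).ne']
  have hrow (i : Fin s) (j) : (1 - H * (E * G * F) : Matrix _ _ K) i.castSucc j = 0 := by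
    have h := congrFun (congrFun hFHM i) j
    rw [Matrix.mul_apply] at h
    simp only [hF, submatrix_apply, Matrix.one_apply, id, ite_mul, one_mul, zero_mul,
      Finset.sum_ite_eq, Finset.mem_univ, if_true] at h
    rw [Matrix.sub_apply, sub_eq_zero, Matrix.one_apply]
    exact h.symm
  have hdiff (i j) : H⁻¹ i j - (E * G * F) i j
      = H⁻¹ i (Fin.last s) * (1 - H * (E * G * F) : Matrix _ _ K) (Fin.last s) j := by
    have h : H⁻¹ - E * G * F = H⁻¹ * (1 - H * (E * G * F)) := by
      rw [Matrix.mul_sub, Matrix.mul_one, nonsing_inv_mul_cancel_left _ _ hHdet]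
    rw [← Matrix.sub_apply, h, Matrix.mul_apply, Fin.sum_univ_castSucc]
    simp only [hrow, mul_zero, Finset.sum_const_zero, zero_add]
  have hw (j) := hdiff (Fin.last s) j
  simp only [hlast, sub_zero] at hw
  have hk : H⁻¹ (Fin.last s) (Fin.last s) ≠ 0 := by
    intro h0
    have h := congrFun (congrFun (nonsing_inv_mul H hHdet) (Fin.last s)) (Fin.last s)
    rw [Matrix.mul_apply, Finset.sum_eq_zero fun x _ => by rw [hw x, h0, zero_mul, zero_mul],
      Matrix.one_apply_eq] at h
    exact zero_ne_one h
  ext i j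
  have h := hdiff i j
  simp only [Matrix.sub_apply, Matrix.smul_apply, vecMulVec_apply, smul_eq_mul]
  rw [hw j, mul_left_comm (H⁻¹ i _), inv_mul_cancel_left₀ hk, ← h, sub_sub_cancel]

/-- Downdating formula relating the generalized Nyström approximation `Â` to the
approximation `Â_{-s,-s}` computed with the last columns of `Ω` and `Φ` omitted:
`Â_{-s,-s} = Â - (A Ω H⁻¹ eₛ)(eₛ* H⁻¹ Φ* A) / [H⁻¹]_{s,s}`. -/
theorem gn_leave_pair_out_update (m n s : ℕ)
    (A : Matrix (Fin m) (Fin n) ℂ)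
    (Ω : Matrix (Fin n) (Fin (s + 1)) ℂ) (Φ : Matrix (Fin m) (Fin (s + 1)) ℂ)
    (hH : IsUnit (Φᴴ * A * Ω))
    (hHbar : IsUnit ((Φ.submatrix id Fin.castSucc)ᴴ * A * Ω.submatrix id Fin.castSucc)) :
    (A * Ω.submatrix id Fin.castSucc) *
        ((Φ.submatrix id Fin.castSucc)ᴴ * A * Ω.submatrix id Fin.castSucc)⁻¹ *
        ((Φ.submatrix id Fin.castSucc)ᴴ * A)
      = (A * Ω) * (Φᴴ * A * Ω)⁻¹ * (Φᴴ * A) -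
        ((Φᴴ * A * Ω)⁻¹ (Fin.last s) (Fin.last s))⁻¹ •
          Matrix.vecMulVec
            (fun i => (A * Ω * (Φᴴ * A * Ω)⁻¹) i (Fin.last s))
            (fun k => ((Φᴴ * A * Ω)⁻¹ * (Φᴴ * A)) (Fin.last s) k) := by
  have hΩ : Ω.submatrix id Fin.castSucc
      = Ω * (1 : Matrix (Fin (s + 1)) (Fin (s + 1)) ℂ).submatrix id Fin.castSucc := by
    ext i j
    simp [Matrix.mul_apply, Matrix.one_apply]
  have hΦ : (Φ.submatrix id Fin.castSucc)ᴴ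
      = (1 : Matrix (Fin (s + 1)) (Fin (s + 1)) ℂ).submatrix Fin.castSucc id * Φᴴ := by
    ext i j
    simp [Matrix.mul_apply, Matrix.one_apply]
  have hcore : (Φ.submatrix id Fin.castSucc)ᴴ * A * Ω.submatrix id Fin.castSucc
      = (Φᴴ * A * Ω).submatrix Fin.castSucc Fin.castSucc := by
    ext i j
    simp [Matrix.mul_apply]
  rw [hcore] at hHbar ⊢
  have key := inv_submatrix_castSucc_padded (Φᴴ * A * Ω) hH hHbar
  rw [hΩ, hΦ]
  generalize (Φᴴ * A * Ω).submatrix Fin.castSucc Fin.castSucc = S at key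
  generalize (Φᴴ * A * Ω)⁻¹ = K at key ⊢
  calc _ = A * Ω * ((1 : Matrix (Fin (s + 1)) (Fin (s + 1)) ℂ).submatrix id Fin.castSucc * S⁻¹ *
        (1 : Matrix (Fin (s + 1)) (Fin (s + 1)) ℂ).submatrix Fin.castSucc id) * (Φᴴ * A) := by
        simp only [Matrix.mul_assoc]
    _ = _ := by
      rw [key, Matrix.mul_sub, Matrix.sub_mul, Matrix.mul_smul, Matrix.smul_mul,
        mul_vecMulVec, vecMulVec_mul]
      rfl
end

section
/- Let A be an m×n complex matrix, Ω an n×s complex matrix with columns ω₁,…,ωₛ, and Φ an m×s complex matrix with columns φ₁,…,φₛ. Suppose the core matrix H = Φ* A Ω is invertible, and fix indices j, ℓ ∈ {1,…,s} such that the (s−1)×(s−1) matrix H_{−ℓ,−j}, obtained from H by deleting its ℓ-th row and j-th column, is invertible. Let Â_{−ℓ,−j} = (A Ω_{:,−j}) (H_{−ℓ,−j})⁻¹ ((Φ_{:,−ℓ})* A). Then [H⁻¹]_{j,ℓ} ≠ 0 and |φ_ℓ* (A − Â_{−ℓ,−j}) ω_j| = 1 / |[H⁻¹]_{j,ℓ}|.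 -/
open Matrix

/-- The Schur complement of a minor of an invertible matrix is inverse to the corresponding
entry of the inverse matrix. -/
theorem Matrix.schur_compl_mul_inv_apply {R : Type*} [CommRing R] {s : ℕ}
    (H : Matrix (Fin (s + 1)) (Fin (s + 1)) R) (hH : IsUnit H) (j ℓ : Fin (s + 1))
    (hsub : IsUnit (H.submatrix ℓ.succAbove j.succAbove)) :
    (H ℓ j - (fun k => H ℓ (j.succAbove k)) ⬝ᵥ
      (H.submatrix ℓ.succAbove j.succAbove)⁻¹ *ᵥ fun k => H (ℓ.succAbove k) j) * H⁻¹ j ℓ = 1 := by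
  set M := H.submatrix ℓ.succAbove j.succAbove
  set c : Fin s → R := fun k => H (ℓ.succAbove k) j
  set g : Fin s → R := fun k => H⁻¹ (j.succAbove k) ℓ
  have hmul : H * H⁻¹ = 1 := mul_nonsing_inv H ((isUnit_iff_isUnit_det H).mp hH)
  have hrow : H ℓ j * H⁻¹ j ℓ + (fun k => H ℓ (j.succAbove k)) ⬝ᵥ g = 1 := by
    have h := congrFun₂ hmul ℓ ℓ
    rwa [mul_apply, Fin.sum_univ_succAbove _ j, one_apply_eq] at h
  have hrest : M *ᵥ g = -(H⁻¹ j ℓ • c) := by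
    funext i
    have h := congrFun₂ hmul (ℓ.succAbove i) ℓ
    rw [mul_apply, Fin.sum_univ_succAbove _ j, one_apply_ne (Fin.succAbove_ne ℓ i)] at h
    rw [Pi.neg_apply, Pi.smul_apply, smul_eq_mul, mul_comm]
    exact eq_neg_of_add_eq_zero_right h
  have hsolve : g = -(H⁻¹ j ℓ • M⁻¹ *ᵥ c) := by
    rw [← mulVec_smul, ← mulVec_neg, ← hrest, mulVec_mulVec,
      nonsing_inv_mul M ((isUnit_iff_isUnit_det M).mp hsub), one_mulVec]
  rw [hsolve, dotProduct_neg, dotProduct_smul, smul_eq_mul] at hrow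
  linear_combination hrow

/-- For the generalized Nyström approximation `Â_{-ℓ,-j}` computed with the `ℓ`-th
left and `j`-th right sample vectors omitted, the residual satisfies
`|φ_ℓ* (A - Â_{-ℓ,-j}) ω_j| = 1 / |[H⁻¹]_{j,ℓ}|` (and `[H⁻¹]_{j,ℓ} ≠ 0`). -/
theorem gn_lpo_entry (m n s : ℕ)
    (A : Matrix (Fin m) (Fin n) ℂ)
    (Ω : Matrix (Fin n) (Fin (s + 1)) ℂ) (Φ : Matrix (Fin m) (Fin (s + 1)) ℂ)
    (hH : IsUnit (Φᴴ * A * Ω)) (j ℓ : Fin (s + 1))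
    (hsub : IsUnit ((Φᴴ * A * Ω).submatrix ℓ.succAbove j.succAbove)) :
    (Φᴴ * A * Ω)⁻¹ j ℓ ≠ 0 ∧
    ‖(star fun i => Φ i ℓ) ⬝ᵥ
        (A - (A * Ω.submatrix id j.succAbove) *
            ((Φᴴ * A * Ω).submatrix ℓ.succAbove j.succAbove)⁻¹ *
            ((Φ.submatrix id ℓ.succAbove)ᴴ * A)).mulVec (fun i => Ω i j)‖
      = 1 / ‖(Φᴴ * A * Ω)⁻¹ j ℓ‖ := by
  have hentry : (star fun i => Φ i ℓ) ⬝ᵥ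
        (A - (A * Ω.submatrix id j.succAbove) *
            ((Φᴴ * A * Ω).submatrix ℓ.succAbove j.succAbove)⁻¹ *
            ((Φ.submatrix id ℓ.succAbove)ᴴ * A)).mulVec (fun i => Ω i j) =
      (Φᴴ * A * Ω) ℓ j - (fun k => (Φᴴ * A * Ω) ℓ (j.succAbove k)) ⬝ᵥ
        ((Φᴴ * A * Ω).submatrix ℓ.succAbove j.succAbove)⁻¹ *ᵥ
          fun k => (Φᴴ * A * Ω) (ℓ.succAbove k) j := by
    generalize ((Φᴴ * A * Ω).submatrix ℓ.succAbove j.succAbove)⁻¹ = N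
    have hleft : (star fun i => Φ i ℓ) ᵥ* (A * Ω.submatrix id j.succAbove) =
        fun k => (Φᴴ * A * Ω) ℓ (j.succAbove k) := by
      rw [Matrix.mul_assoc]
      rfl
    have hright : ((Φ.submatrix id ℓ.succAbove)ᴴ * A) *ᵥ (fun i => Ω i j) =
        fun k => (Φᴴ * A * Ω) (ℓ.succAbove k) j := rfl
    have hcorner : (star fun i => Φ i ℓ) ⬝ᵥ A *ᵥ (fun i => Ω i j) = (Φᴴ * A * Ω) ℓ j := by
      rw [Matrix.mul_assoc]
      rfl
    rw [sub_mulVec, dotProduct_sub, hcorner, ← mulVec_mulVec, ← mulVec_mulVec, hright,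
      dotProduct_mulVec, hleft]
  have hone := schur_compl_mul_inv_apply _ hH j ℓ hsub
  rw [← hentry] at hone
  refine ⟨right_ne_zero_of_mul_eq_one hone, ?_⟩
  rw [eq_one_div_of_mul_eq_one_left hone, norm_div, norm_one]
end

section
/- Let A be an m×n complex matrix, Ω an n×s complex matrix with columns ω₁,…,ωₛ, and Φ an m×s complex matrix with columns φ₁,…,φₛ. Suppose the core matrix H = Φ* A Ω is invertible and that for every pair of indices j, ℓ ∈ {1,…,s} the matrix H_{−ℓ,−j}, obtained from H by deleting its ℓ-th row and j-th column, is invertible. For each (j,ℓ) let Â_{−ℓ,−j} = (A Ω_{:,−j}) (H_{−ℓ,−j})⁻¹ ((Φ_{:,−ℓ})* A). Then the leave-pair-out estimator satisfies (1/s) (Σ_{j=1}^s Σ_{ℓ=1}^s |φ_ℓ* (A − Â_{−ℓ,−j}) ω_j|²)^{1/2} = (1/s) (Σ_{j=1}^s Σ_{ℓ=1}^s 1/|[H⁻¹]_{j,ℓ}|²)^{1/2}. -/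
open Matrix

/-- The Schur complement of the minor obtained by deleting row `ℓ` and column `j` of an invertible
matrix `H` is the reciprocal of the entry `(j, ℓ)` of `H⁻¹`. -/
theorem schur_complement_minor_mul_inv_apply {K : Type*} [Field K] {s : ℕ}
    (H : Matrix (Fin (s + 1)) (Fin (s + 1)) K) (hH : IsUnit H) (j ℓ : Fin (s + 1))
    (hsub : IsUnit (H.submatrix ℓ.succAbove j.succAbove)) :
    (H ℓ j - (fun k => H ℓ (j.succAbove k)) ⬝ᵥ
      (H.submatrix ℓ.succAbove j.succAbove)⁻¹ *ᵥ fun k => H (ℓ.succAbove k) j) * H⁻¹ j ℓ = 1 := by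
  set M := H.submatrix ℓ.succAbove j.succAbove with hM
  have hmul : H * H⁻¹ = 1 := mul_nonsing_inv H ((isUnit_iff_isUnit_det H).1 hH)
  have hMinv : M⁻¹ * M = 1 := nonsing_inv_mul M ((isUnit_iff_isUnit_det M).1 hsub)
  have hrow (i : Fin (s + 1)) :
      H i j * H⁻¹ j ℓ + ∑ k, H i (j.succAbove k) * H⁻¹ (j.succAbove k) ℓ
        = (1 : Matrix _ _ K) i ℓ := by
    rw [← hmul, mul_apply, Fin.sum_univ_succAbove _ j]
  have hcol : M *ᵥ (fun k => H⁻¹ (j.succAbove k) ℓ)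
      = -(H⁻¹ j ℓ • fun k => H (ℓ.succAbove k) j) := by
    ext i
    have h := hrow (ℓ.succAbove i)
    rw [one_apply_ne (Fin.succAbove_ne ℓ i)] at h
    simp only [mulVec, dotProduct, hM, submatrix_apply, Pi.neg_apply, Pi.smul_apply, smul_eq_mul]
    linear_combination h
  have hsol : (fun k => H⁻¹ (j.succAbove k) ℓ)
      = -(H⁻¹ j ℓ • M⁻¹ *ᵥ fun k => H (ℓ.succAbove k) j) := by
    rw [← mulVec_smul, ← mulVec_neg, ← hcol, mulVec_mulVec, hMinv, one_mulVec]
  have h := hrow ℓ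
  rw [one_apply_eq] at h
  change _ + (fun k => H ℓ (j.succAbove k)) ⬝ᵥ (fun k => H⁻¹ (j.succAbove k) ℓ) = 1 at h
  rw [hsol, dotProduct_neg, dotProduct_smul, smul_eq_mul] at h
  linear_combination h

/-- The bilinear form `φ_ℓ* (A - Â) ω_j` of a generalized Nyström residual, with core inverse `N`
and with `φ_ℓ`, `ω_j` left out of the sketches, in terms of the entries of `Φᴴ * A * Ω`. -/
theorem star_dotProduct_nystrom_residual_mulVec {R : Type*} [CommRing R] [StarRing R]
    {m n s : ℕ} (A : Matrix (Fin m) (Fin n) R)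
    (Ω : Matrix (Fin n) (Fin (s + 1)) R) (Φ : Matrix (Fin m) (Fin (s + 1)) R)
    (N : Matrix (Fin s) (Fin s) R) (j ℓ : Fin (s + 1)) :
    (star fun i => Φ i ℓ) ⬝ᵥ
        (A - (A * Ω.submatrix id j.succAbove) * N *
          ((Φ.submatrix id ℓ.succAbove)ᴴ * A)) *ᵥ (fun i => Ω i j)
      = (Φᴴ * A * Ω) ℓ j - (fun k => (Φᴴ * A * Ω) ℓ (j.succAbove k)) ⬝ᵥ
          N *ᵥ fun k => (Φᴴ * A * Ω) (ℓ.succAbove k) j := by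
  have hleft : (fun k => (Φᴴ * A * Ω) ℓ (j.succAbove k))
      = (star fun i => Φ i ℓ) ᵥ* (A * Ω.submatrix id j.succAbove) := by
    rw [← vecMul_vecMul]
    rfl
  have hright : (fun k => (Φᴴ * A * Ω) (ℓ.succAbove k) j)
      = ((Φ.submatrix id ℓ.succAbove)ᴴ * A) *ᵥ fun i => Ω i j := rfl
  have hentry : (Φᴴ * A * Ω) ℓ j = (star fun i => Φ i ℓ) ⬝ᵥ A *ᵥ fun i => Ω i j := by
    rw [dotProduct_mulVec]
    rfl
  rw [hleft, hright, hentry, sub_mulVec, dotProduct_sub, ← mulVec_mulVec, ← mulVec_mulVec,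
    dotProduct_mulVec _ (A * _)]

/-- Fast replicate formula for the leave-pair-out (LPO) error estimator of the
generalized Nyström approximation:
`(1/s)(Σ_{j,ℓ} |φ_ℓ* (A - Â_{-ℓ,-j}) ω_j|²)^{1/2} = (1/s)(Σ_{j,ℓ} 1/|[H⁻¹]_{j,ℓ}|²)^{1/2}`. -/
theorem gn_lpo_replicate_formula (m n s : ℕ)
    (A : Matrix (Fin m) (Fin n) ℂ)
    (Ω : Matrix (Fin n) (Fin (s + 1)) ℂ) (Φ : Matrix (Fin m) (Fin (s + 1)) ℂ)
    (hH : IsUnit (Φᴴ * A * Ω))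
    (hsub : ∀ j ℓ : Fin (s + 1),
      IsUnit ((Φᴴ * A * Ω).submatrix ℓ.succAbove j.succAbove)) :
    (1 / ((s : ℝ) + 1)) * Real.sqrt (∑ j : Fin (s + 1), ∑ ℓ : Fin (s + 1),
        ‖(star fun i => Φ i ℓ) ⬝ᵥ
            (A - (A * Ω.submatrix id j.succAbove) *
                ((Φᴴ * A * Ω).submatrix ℓ.succAbove j.succAbove)⁻¹ *
                ((Φ.submatrix id ℓ.succAbove)ᴴ * A)).mulVec (fun i => Ω i j)‖ ^ 2)
      = (1 / ((s : ℝ) + 1)) * Real.sqrt (∑ j : Fin (s + 1), ∑ ℓ : Fin (s + 1),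
          1 / ‖(Φᴴ * A * Ω)⁻¹ j ℓ‖ ^ 2) := by
  congr 2
  refine Finset.sum_congr rfl fun j _ => Finset.sum_congr rfl fun ℓ _ => ?_
  rw [star_dotProduct_nystrom_residual_mulVec,
    eq_inv_of_mul_eq_one_left (schur_complement_minor_mul_inv_apply _ hH j ℓ (hsub j ℓ)),
    norm_inv, inv_pow, one_div]
end

section
/- Let A be an m×n complex matrix, Ω an n×s complex matrix with columns ω₁,…,ωₛ, and Φ an m×s complex matrix with columns φ₁,…,φₛ. Suppose the core matrix H = Φ* A Ω is invertible and that for every index j ∈ {1,…,s} the matrix H_{−j,−j}, obtained from H by deleting its j-th row and j-th column, is invertible. For each j let Â_{−j,−j} = (A Ω_{:,−j}) (H_{−j,−j})⁻¹ ((Φ_{:,−j})* A). Then the leave-twins-out estimator satisfies (1/√s) (Σ_{j=1}^s |φ_j* (A − Â_{−j,−j}) ω_j|²)^{1/2} = (1/√s) (Σ_{j=1}^s 1/|[H⁻¹]_{j,j}|²)^{1/2}. -/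
open Matrix

/-- The Schur complement of the submatrix deleting row and column `j` is the multiplicative inverse
of the `j`-th diagonal entry of the inverse matrix. -/
lemma Matrix.schurComplement_succAbove_mul_inv_apply {R : Type*} [CommRing R] {s : ℕ}
    (H : Matrix (Fin (s + 1)) (Fin (s + 1)) R) (hH : IsUnit H) (j : Fin (s + 1))
    (hD : IsUnit (H.submatrix j.succAbove j.succAbove)) :
    (H - H.submatrix id j.succAbove * (H.submatrix j.succAbove j.succAbove)⁻¹ *
      H.submatrix j.succAbove id) j j * H⁻¹ j j = 1 := by
  set D := H.submatrix j.succAbove j.succAbove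
  have hmul : H * H⁻¹ = 1 := H.mul_nonsing_inv ((isUnit_iff_isUnit_det H).1 hH)
  have hDinv : D⁻¹ * D = 1 := D.nonsing_inv_mul ((isUnit_iff_isUnit_det D).1 hD)
  set x : Fin s → R := fun k => H⁻¹ (j.succAbove k) j
  set c : Fin s → R := fun k => H (j.succAbove k) j
  set r : Fin s → R := fun k => H j (j.succAbove k)
  have hrow : H j j * H⁻¹ j j + r ⬝ᵥ x = 1 := by
    have := congrFun (congrFun hmul j) j
    rwa [mul_apply, Fin.sum_univ_succAbove _ j, one_apply_eq] at this
  have hrest : H⁻¹ j j • c + D *ᵥ x = 0 := by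
    ext k
    have := congrFun (congrFun hmul (j.succAbove k)) j
    rw [mul_apply, Fin.sum_univ_succAbove _ j, one_apply_ne (Fin.succAbove_ne j k)] at this
    rw [mul_comm] at this
    exact this
  have hsolve : x = -(H⁻¹ j j • D⁻¹ *ᵥ c) := by
    have := congrArg (D⁻¹ *ᵥ ·) hrest
    simp only [mulVec_add, mulVec_smul, mulVec_mulVec, hDinv, one_mulVec, mulVec_zero] at this
    exact eq_neg_of_add_eq_zero_right this
  have hentry : (H.submatrix id j.succAbove * D⁻¹ * H.submatrix j.succAbove id) j j =
      r ⬝ᵥ D⁻¹ *ᵥ c := by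
    rw [Matrix.mul_assoc]
    rfl
  rw [hsolve, dotProduct_neg, dotProduct_smul, smul_eq_mul] at hrow
  rw [sub_apply, hentry]
  linear_combination hrow

/-- The leave-twins-out residual of the generalized Nyström approximation, tested against the
omitted pair of sample vectors, is the reciprocal of a diagonal entry of the inverse core matrix. -/
lemma gn_lto_residual_eq_inv {m n s : ℕ}
    (A : Matrix (Fin m) (Fin n) ℂ)
    (Ω : Matrix (Fin n) (Fin (s + 1)) ℂ) (Φ : Matrix (Fin m) (Fin (s + 1)) ℂ)
    (hH : IsUnit (Φᴴ * A * Ω)) (j : Fin (s + 1))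
    (hsub : IsUnit ((Φᴴ * A * Ω).submatrix j.succAbove j.succAbove)) :
    (star fun i => Φ i j) ⬝ᵥ
        (A - (A * Ω.submatrix id j.succAbove) *
            ((Φᴴ * A * Ω).submatrix j.succAbove j.succAbove)⁻¹ *
            ((Φ.submatrix id j.succAbove)ᴴ * A)).mulVec (fun i => Ω i j) =
      ((Φᴴ * A * Ω)⁻¹ j j)⁻¹ := by
  refine eq_inv_of_mul_eq_one_left ?_
  rw [← schurComplement_succAbove_mul_inv_apply _ hH j hsub]
  congr 1
  have hentry (M : Matrix (Fin m) (Fin n) ℂ) :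
      (star fun i => Φ i j) ⬝ᵥ M *ᵥ (fun i => Ω i j) = (Φᴴ * M * Ω) j j := by
    rw [Matrix.mul_assoc]
    rfl
  have hleft : (Φᴴ * A * Ω).submatrix id j.succAbove = Φᴴ * A * Ω.submatrix id j.succAbove := rfl
  have hright : (Φᴴ * A * Ω).submatrix j.succAbove id =
      (Φ.submatrix id j.succAbove)ᴴ * A * Ω := rfl
  rw [hentry, hleft, hright]
  simp only [Matrix.mul_sub, Matrix.sub_mul, Matrix.mul_assoc]

/-- Fast replicate formula for the leave-twins-out (LTO) error estimator of the
generalized Nyström approximation: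
`(1/√s)(Σ_j |φ_j* (A - Â_{-j,-j}) ω_j|²)^{1/2} = (1/√s)(Σ_j 1/|[H⁻¹]_{j,j}|²)^{1/2}`. -/
theorem gn_lto_replicate_formula (m n s : ℕ)
    (A : Matrix (Fin m) (Fin n) ℂ)
    (Ω : Matrix (Fin n) (Fin (s + 1)) ℂ) (Φ : Matrix (Fin m) (Fin (s + 1)) ℂ)
    (hH : IsUnit (Φᴴ * A * Ω))
    (hsub : ∀ j : Fin (s + 1),
      IsUnit ((Φᴴ * A * Ω).submatrix j.succAbove j.succAbove)) :
    (1 / Real.sqrt ((s : ℝ) + 1)) * Real.sqrt (∑ j : Fin (s + 1),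
        ‖(star fun i => Φ i j) ⬝ᵥ
            (A - (A * Ω.submatrix id j.succAbove) *
                ((Φᴴ * A * Ω).submatrix j.succAbove j.succAbove)⁻¹ *
                ((Φ.submatrix id j.succAbove)ᴴ * A)).mulVec (fun i => Ω i j)‖ ^ 2)
      = (1 / Real.sqrt ((s : ℝ) + 1)) * Real.sqrt (∑ j : Fin (s + 1),
          1 / ‖(Φᴴ * A * Ω)⁻¹ j j‖ ^ 2) := by
  simp only [gn_lto_residual_eq_inv A Ω Φ hH _ (hsub _), norm_inv, inv_pow, one_div]
end

section
/- Let H be an r×s complex matrix with r ≥ s ≥ 1 such that H*H is invertible and such that, writing H_{:,−s} for H with its last column removed, (H_{:,−s})*(H_{:,−s}) is invertible. Then the (s,s) entry of (H*H)⁻¹ is nonzero, and (H*H)⁻¹ − ((H*H)⁻¹ eₛ eₛ* (H*H)⁻¹) / [(H*H)⁻¹]_{s,s} equals the s×s block matrix whose leading (s−1)×(s−1) block is ((H_{:,−s})*(H_{:,−s}))⁻¹ and whose last row and last column are zero, where eₛ is the s-th standard basis vector of ℂ^s. -/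
namespace Matrix

variable {K : Type*} [Field K] {s : ℕ}

/-- If an invertible matrix has an invertible leading principal block of corank one, then the
last diagonal entry of its inverse is nonzero. -/
theorem inv_last_last_ne_zero {A : Matrix (Fin (s + 1)) (Fin (s + 1)) K} (hA : IsUnit A)
    (hA' : IsUnit (A.submatrix Fin.castSucc Fin.castSucc)) :
    A⁻¹ (Fin.last s) (Fin.last s) ≠ 0 := by
  intro h0
  have hmul : A * A⁻¹ = 1 := mul_nonsing_inv A ((isUnit_iff_isUnit_det A).mp hA)
  have hker : A.submatrix Fin.castSucc Fin.castSucc *ᵥ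
      (fun k => A⁻¹ (Fin.castSucc k) (Fin.last s)) = 0 := by
    ext i
    have h := congrFun (congrFun hmul i.castSucc) (Fin.last s)
    rw [mul_apply, Fin.sum_univ_castSucc, h0, one_apply_ne (Fin.castSucc_lt_last i).ne] at h
    simpa [mulVec, dotProduct] using h
  have hcol : (fun k => A⁻¹ (Fin.castSucc k) (Fin.last s)) = 0 :=
    mulVec_injective_of_isUnit hA' (hker.trans (mulVec_zero _).symm)
  have h := congrFun (congrFun hmul (Fin.last s)) (Fin.last s)
  rw [mul_apply, Fin.sum_univ_castSucc, h0] at h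
  simp [fun k => congrFun hcol k] at h

/-- The inverse of the leading principal block of corank one, as the Schur complement of the
last diagonal entry in the inverse of the whole matrix. -/
theorem inv_submatrix_castSucc {A : Matrix (Fin (s + 1)) (Fin (s + 1)) K} (hA : IsUnit A)
    (h0 : A⁻¹ (Fin.last s) (Fin.last s) ≠ 0) :
    (A.submatrix Fin.castSucc Fin.castSucc)⁻¹ =
      (A⁻¹ - (A⁻¹ (Fin.last s) (Fin.last s))⁻¹ •
        vecMulVec (fun i => A⁻¹ i (Fin.last s)) (fun j => A⁻¹ (Fin.last s) j)).submatrix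
          Fin.castSucc Fin.castSucc := by
  have hmul : A⁻¹ * A = 1 := nonsing_inv_mul A ((isUnit_iff_isUnit_det A).mp hA)
  set C := A⁻¹ - (A⁻¹ (Fin.last s) (Fin.last s))⁻¹ •
    vecMulVec (fun i => A⁻¹ i (Fin.last s)) (fun j => A⁻¹ (Fin.last s) j) with hC
  have hCA : C * A = 1 - (A⁻¹ (Fin.last s) (Fin.last s))⁻¹ •
      vecMulVec (fun i => A⁻¹ i (Fin.last s)) ((1 : Matrix _ _ K) (Fin.last s)) := by
    rw [hC, sub_mul, hmul, smul_mul, vecMulVec_mul, ← hmul]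
    rfl
  have hlast (i : Fin (s + 1)) : C i (Fin.last s) = 0 := by
    simp only [hC, sub_apply, smul_apply, vecMulVec_apply, smul_eq_mul]
    field_simp
    ring
  refine inv_eq_left_inv ?_
  ext i j
  have h := congrFun (congrFun hCA i.castSucc) j.castSucc
  rw [mul_apply, Fin.sum_univ_castSucc, hlast] at h
  simpa [mul_apply, vecMulVec_apply, one_apply, (Fin.castSucc_lt_last j).ne'] using h

end Matrix


open Matrix

/-- The `(s+1) × (s+1)` block matrix whose leading `s × s` block is `M` and whose
last row and last column are zero. -/
def extendZero {s : ℕ} (M : Matrix (Fin s) (Fin s) ℂ) :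
    Matrix (Fin (s + 1)) (Fin (s + 1)) ℂ :=
  Matrix.of fun i j =>
    if h : (i : ℕ) < s ∧ (j : ℕ) < s then M ⟨i, h.1⟩ ⟨j, h.2⟩ else 0

/-- For a tall matrix `H` with `H*H` and `(H_{:,-s})*(H_{:,-s})` invertible,
`[(H*H)⁻¹]_{s,s} ≠ 0` and
`(H*H)⁻¹ - ((H*H)⁻¹ eₛ eₛ* (H*H)⁻¹)/[(H*H)⁻¹]_{s,s}` equals the block matrix with
leading block `((H_{:,-s})*(H_{:,-s}))⁻¹` and zero last row and column. -/
theorem gram_inverse_deflation (r s : ℕ) (hrs : s + 1 ≤ r)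
    (H : Matrix (Fin r) (Fin (s + 1)) ℂ)
    (hH : IsUnit (Hᴴ * H))
    (hHbar : IsUnit ((H.submatrix id Fin.castSucc)ᴴ * H.submatrix id Fin.castSucc)) :
    (Hᴴ * H)⁻¹ (Fin.last s) (Fin.last s) ≠ 0 ∧
    (Hᴴ * H)⁻¹ - ((Hᴴ * H)⁻¹ (Fin.last s) (Fin.last s))⁻¹ •
        Matrix.vecMulVec (fun i => (Hᴴ * H)⁻¹ i (Fin.last s))
          (fun j => (Hᴴ * H)⁻¹ (Fin.last s) j)
      = extendZero ((H.submatrix id Fin.castSucc)ᴴ * H.submatrix id Fin.castSucc)⁻¹ := by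
  have hsub : (H.submatrix id Fin.castSucc)ᴴ * H.submatrix id Fin.castSucc =
      (Hᴴ * H).submatrix Fin.castSucc Fin.castSucc := rfl
  rw [hsub] at hHbar ⊢
  have h0 := inv_last_last_ne_zero hH hHbar
  refine ⟨h0, ?_⟩
  rw [inv_submatrix_castSucc hH h0]
  ext i j
  rcases Fin.eq_castSucc_or_eq_last i with ⟨i, rfl⟩ | rfl
  · rcases Fin.eq_castSucc_or_eq_last j with ⟨j, rfl⟩ | rfl
    · simp [extendZero]
    · simp [extendZero, vecMulVec_apply]
      field_simp
      ring
  · simp [extendZero, vecMulVec_apply, h0]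
end

section
/- Let A be an m×n complex matrix, Ω an n×s complex matrix with columns ω₁,…,ωₛ, and Φ an m×r complex matrix with r ≥ s ≥ 1. Suppose the core matrix H = Φ* A Ω satisfies that H*H is invertible, and fix an index j ∈ {1,…,s} such that, writing H_{:,−j} for H with its j-th column removed, (H_{:,−j})*(H_{:,−j}) is invertible. Let Â_{:,−j} = (A Ω_{:,−j})((H_{:,−j})*(H_{:,−j}))⁻¹(H_{:,−j})*(Φ* A). Then [(H*H)⁻¹]_{j,j} ≠ 0 and, with ‖·‖ the Euclidean norm on ℂ^m, ‖(A − Â_{:,−j}) ω_j‖ = ‖A Ω (H*H)⁻¹ e_j‖ / |[(H*H)⁻¹]_{j,j}|, where e_j is the j-th standard basis vector of ℂ^s. -/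
open Matrix

/-- The Euclidean (ℓ²) norm of a complex vector. -/
noncomputable def euclNorm {k : ℕ} (v : Fin k → ℂ) : ℝ :=
  Real.sqrt (∑ i, ‖v i‖ ^ 2)

theorem euclNorm_smul {k : ℕ} (c : ℂ) (v : Fin k → ℂ) :
    euclNorm (c • v) = ‖c‖ * euclNorm v := by
  unfold euclNorm
  simp only [Pi.smul_apply, smul_eq_mul, norm_mul, mul_pow, ← Finset.mul_sum]
  rw [Real.sqrt_mul (sq_nonneg _), Real.sqrt_sq (norm_nonneg _)]

/-- Splitting off the `j`-th column in a matrix-vector product. -/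
theorem mulVec_eq_smul_col_add_submatrix_succAbove {ι : Type*} {s : ℕ}
    (X : Matrix ι (Fin (s + 1)) ℂ) (g : Fin (s + 1) → ℂ) (j : Fin (s + 1)) :
    X *ᵥ g = g j • X.col j + X.submatrix id j.succAbove *ᵥ (g ∘ j.succAbove) := by
  ext i
  simp [mulVec, dotProduct, Fin.sum_univ_succAbove _ j, mul_comm]

/-- If `H*H g = e_j`, then deleting the `j`-th entry of `g` gives `-g_j` times the coefficients
of the least-squares fit of the `j`-th column of `H` by the other columns. -/
theorem comp_succAbove_eq_neg_smul_leastSquares {r s : ℕ}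
    (H : Matrix (Fin r) (Fin (s + 1)) ℂ) (j : Fin (s + 1)) (g : Fin (s + 1) → ℂ)
    (hg : (Hᴴ * H) *ᵥ g = Pi.single j 1)
    (hj : IsUnit ((H.submatrix id j.succAbove)ᴴ * H.submatrix id j.succAbove)) :
    g ∘ j.succAbove = -(g j • ((H.submatrix id j.succAbove)ᴴ * H.submatrix id j.succAbove)⁻¹ *ᵥ
      (H.submatrix id j.succAbove)ᴴ *ᵥ H.col j) := by
  have orth : (H.submatrix id j.succAbove)ᴴ *ᵥ (H *ᵥ g) = 0 := by
    ext i
    have := congrFun hg (j.succAbove i)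
    rw [← mulVec_mulVec, Pi.single_eq_of_ne (Fin.succAbove_ne j i)] at this
    exact this
  rw [mulVec_eq_smul_col_add_submatrix_succAbove H g j] at orth
  set M := H.submatrix id j.succAbove
  rw [mulVec_add, mulVec_smul, mulVec_mulVec] at orth
  have hinv : (Mᴴ * M)⁻¹ * (Mᴴ * M) = 1 :=
    nonsing_inv_mul _ ((isUnit_iff_isUnit_det _).mp hj)
  have := congrArg ((Mᴴ * M)⁻¹ *ᵥ ·) (eq_neg_of_add_eq_zero_right orth)
  simpa only [mulVec_mulVec, hinv, one_mulVec, mulVec_neg, mulVec_smul] using this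

/-- For the discrepant generalized Nyström approximation `Â_{:,-j}` computed with
the `j`-th right sample vector omitted, `[(H*H)⁻¹]_{j,j} ≠ 0` and
`‖(A - Â_{:,-j}) ω_j‖ = ‖A Ω (H*H)⁻¹ e_j‖ / |[(H*H)⁻¹]_{j,j}|`. -/
theorem gn_lro_entry (m n s r : ℕ) (hrs : s + 1 ≤ r)
    (A : Matrix (Fin m) (Fin n) ℂ)
    (Ω : Matrix (Fin n) (Fin (s + 1)) ℂ) (Φ : Matrix (Fin m) (Fin r) ℂ)
    (hH : IsUnit ((Φᴴ * A * Ω)ᴴ * (Φᴴ * A * Ω))) (j : Fin (s + 1))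
    (hj : IsUnit (((Φᴴ * A * Ω).submatrix id j.succAbove)ᴴ *
      ((Φᴴ * A * Ω).submatrix id j.succAbove))) :
    ((Φᴴ * A * Ω)ᴴ * (Φᴴ * A * Ω))⁻¹ j j ≠ 0 ∧
    euclNorm
        ((A - (A * Ω.submatrix id j.succAbove) *
            (((Φᴴ * A * Ω).submatrix id j.succAbove)ᴴ *
              ((Φᴴ * A * Ω).submatrix id j.succAbove))⁻¹ *
            ((Φᴴ * A * Ω).submatrix id j.succAbove)ᴴ *
            (Φᴴ * A)).mulVec (fun i => Ω i j))
      = euclNorm (fun i => (A * Ω * ((Φᴴ * A * Ω)ᴴ * (Φᴴ * A * Ω))⁻¹) i j) /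
          ‖((Φᴴ * A * Ω)ᴴ * (Φᴴ * A * Ω))⁻¹ j j‖ := by
  set H := Φᴴ * A * Ω
  set g : Fin (s + 1) → ℂ := ((Hᴴ * H)⁻¹).col j with hgdef
  have hg : (Hᴴ * H) *ᵥ g = Pi.single j 1 := by
    rw [hgdef, ← mulVec_single_one, mulVec_mulVec,
      mul_nonsing_inv _ ((isUnit_iff_isUnit_det _).mp hH), one_mulVec]
  have hcomp := comp_succAbove_eq_neg_smul_leastSquares H j g hg hj
  have hne : g j ≠ 0 := by
    intro h0
    have hzero : g = 0 := by
      ext i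
      rcases Fin.eq_self_or_eq_succAbove j i with rfl | ⟨k, rfl⟩
      · exact h0
      · simpa [h0] using congrFun hcomp k
    simpa [hzero] using congrFun hg j
  refine ⟨hne, ?_⟩
  have hcol : (Φᴴ * A) *ᵥ Ω.col j = H.col j := rfl
  have key : (A * Ω) *ᵥ g = g j • ((A - (A * Ω.submatrix id j.succAbove) *
      ((H.submatrix id j.succAbove)ᴴ * H.submatrix id j.succAbove)⁻¹ *
      (H.submatrix id j.succAbove)ᴴ * (Φᴴ * A)) *ᵥ Ω.col j) := by
    rw [← mulVec_mulVec, mulVec_eq_smul_col_add_submatrix_succAbove Ω g j, hcomp, sub_mulVec,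
      ← mulVec_mulVec _ _ (Φᴴ * A), hcol]
    simp only [mulVec_add, mulVec_smul, mulVec_neg, mulVec_mulVec, Matrix.mul_assoc,
      sub_eq_add_neg, smul_add, smul_neg]
  have hrhs : (fun i => (A * Ω * (Hᴴ * H)⁻¹) i j) = (A * Ω) *ᵥ g := rfl
  rw [hrhs, key, euclNorm_smul]
  exact (mul_div_cancel_left₀ _ (norm_ne_zero_iff.mpr hne)).symm
end

section
/- Let A be an m×n complex matrix, Ω an n×s complex matrix with columns ω₁,…,ωₛ, and Φ an m×r complex matrix with r ≥ s ≥ 1. Suppose the core matrix H = Φ* A Ω satisfies that H*H is invertible, and that for every j ∈ {1,…,s}, writing H_{:,−j} for H with its j-th column removed, (H_{:,−j})*(H_{:,−j}) is invertible. For each j let Â_{:,−j} = (A Ω_{:,−j})((H_{:,−j})*(H_{:,−j}))⁻¹(H_{:,−j})*(Φ* A). Suppose further that A Ω = Q R where Q ∈ ℂ^{m×s} has orthonormal columns (Q*Q = I) and R ∈ ℂ^{s×s}. Then the leave-right-out estimator satisfies (1/√s)(Σ_{j=1}^s ‖(A − Â_{:,−j}) ω_j‖²)^{1/2} = (1/√s)(Σ_{j=1}^s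 ‖R (H*H)⁻¹ e_j‖² / [(H*H)⁻¹]_{j,j}²)^{1/2}, where e_j is the j-th standard basis vector of ℂ^s and ‖·‖ denotes the Euclidean norm. -/
open Matrix

theorem mulVec_insertNth {p : Type*} {s : ℕ} (M : Matrix p (Fin (s + 1)) ℂ) (j : Fin (s + 1))
    (a : ℂ) (y : Fin s → ℂ) :
    M *ᵥ (j.insertNth a y : Fin (s + 1) → ℂ) =
      a • (fun i => M i j) + M.submatrix id j.succAbove *ᵥ y := by
  ext i
  simp [Matrix.mulVec, dotProduct, Fin.sum_univ_succAbove _ j, mul_comm]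

theorem sq_euclNorm {k : ℕ} (v : Fin k → ℂ) : euclNorm v ^ 2 = ∑ i, ‖v i‖ ^ 2 :=
  Real.sq_sqrt (by positivity)

theorem ofReal_sq_euclNorm {k : ℕ} (v : Fin k → ℂ) :
    ((euclNorm v ^ 2 : ℝ) : ℂ) = star v ⬝ᵥ v := by
  simp [sq_euclNorm, dotProduct, Complex.conj_mul']

theorem sq_euclNorm_smul {k : ℕ} (c : ℂ) (v : Fin k → ℂ) :
    euclNorm (c • v) ^ 2 = ‖c‖ ^ 2 * euclNorm v ^ 2 := by
  simp [sq_euclNorm, mul_pow, Finset.mul_sum]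

theorem sq_euclNorm_mulVec_of_conjTranspose_mul_self {k l : ℕ} (Q : Matrix (Fin k) (Fin l) ℂ)
    (hQ : Qᴴ * Q = 1) (v : Fin l → ℂ) : euclNorm (Q *ᵥ v) ^ 2 = euclNorm v ^ 2 := by
  apply Complex.ofReal_injective
  rw [ofReal_sq_euclNorm, ofReal_sq_euclNorm, star_mulVec, dotProduct_mulVec, vecMul_vecMul, hQ,
    vecMul_one]

/-- The residual coefficient vector of the least-squares regression of column `j` of `H` on the
remaining columns is the `j`-th column of `(Hᴴ * H)⁻¹`, normalized to have `j`-th entry `1`. -/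
theorem insertNth_leastSquares_eq_smul_inv_col {p : Type*} [Fintype p] {s : ℕ}
    (H : Matrix p (Fin (s + 1)) ℂ) (j : Fin (s + 1)) (hH : IsUnit (Hᴴ * H))
    (hj : IsUnit ((H.submatrix id j.succAbove)ᴴ * H.submatrix id j.succAbove)) :
    (j.insertNth 1 (-(((H.submatrix id j.succAbove)ᴴ * H.submatrix id j.succAbove)⁻¹ *
        (H.submatrix id j.succAbove)ᴴ) *ᵥ fun i => H i j) : Fin (s + 1) → ℂ) =
      ((Hᴴ * H)⁻¹ j j)⁻¹ • fun i => (Hᴴ * H)⁻¹ i j := by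
  set K := H.submatrix id j.succAbove with hK
  set h : p → ℂ := fun i => H i j with hh
  set v : Fin (s + 1) → ℂ := j.insertNth 1 (-((Kᴴ * K)⁻¹ * Kᴴ) *ᵥ h) with hv
  have normal_eq : Kᴴ *ᵥ (H *ᵥ v) = 0 := by
    rw [hv, mulVec_insertNth, ← hK, ← hh, one_smul, mulVec_add, mulVec_mulVec, mulVec_mulVec,
      Matrix.mul_neg, ← Matrix.mul_assoc, Matrix.mul_nonsing_inv _
        ((Matrix.isUnit_iff_isUnit_det _).mp hj), Matrix.one_mul, neg_mulVec, add_neg_cancel]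
  have gram_mulVec : (Hᴴ * H) *ᵥ v = Pi.single j (((Hᴴ * H) *ᵥ v) j) := by
    ext i
    rcases Fin.eq_self_or_eq_succAbove j i with rfl | ⟨k, rfl⟩
    · simp
    · rw [Pi.single_eq_of_ne (Fin.succAbove_ne j k), ← mulVec_mulVec]
      exact congrFun normal_eq k
  set c := ((Hᴴ * H) *ᵥ v) j
  have v_eq : v = c • fun i => (Hᴴ * H)⁻¹ i j := by
    have := congrArg ((Hᴴ * H)⁻¹ *ᵥ ·) gram_mulVec
    simp only [mulVec_mulVec, Matrix.nonsing_inv_mul _ ((Matrix.isUnit_iff_isUnit_det _).mp hH),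
      one_mulVec] at this
    rw [this]
    ext i
    simp [mul_comm]
  have v_self : c * (Hᴴ * H)⁻¹ j j = 1 := by
    have := congrFun v_eq j
    simpa [hv] using this.symm
  rw [v_eq, eq_inv_of_mul_eq_one_left v_self]

/-- Fast replicate formula for the leave-right-out (LRO) error estimator of the
discrepant generalized Nyström approximation: with `A Ω = Q R` a QR factorization,
`(1/√s)(Σ_j ‖(A - Â_{:,-j}) ω_j‖²)^{1/2}
  = (1/√s)(Σ_j ‖R (H*H)⁻¹ e_j‖² / [(H*H)⁻¹]_{j,j}²)^{1/2}`. -/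
theorem gn_lro_replicate_formula (m n s r : ℕ) (hrs : s + 1 ≤ r)
    (A : Matrix (Fin m) (Fin n) ℂ)
    (Ω : Matrix (Fin n) (Fin (s + 1)) ℂ) (Φ : Matrix (Fin m) (Fin r) ℂ)
    (hH : IsUnit ((Φᴴ * A * Ω)ᴴ * (Φᴴ * A * Ω)))
    (hj : ∀ j : Fin (s + 1),
      IsUnit (((Φᴴ * A * Ω).submatrix id j.succAbove)ᴴ *
        ((Φᴴ * A * Ω).submatrix id j.succAbove)))
    (Q : Matrix (Fin m) (Fin (s + 1)) ℂ) (R : Matrix (Fin (s + 1)) (Fin (s + 1)) ℂ)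
    (hQ : Qᴴ * Q = 1) (hQR : A * Ω = Q * R) :
    (1 / Real.sqrt ((s : ℝ) + 1)) * Real.sqrt (∑ j : Fin (s + 1),
        euclNorm
            ((A - (A * Ω.submatrix id j.succAbove) *
                (((Φᴴ * A * Ω).submatrix id j.succAbove)ᴴ *
                  ((Φᴴ * A * Ω).submatrix id j.succAbove))⁻¹ *
                ((Φᴴ * A * Ω).submatrix id j.succAbove)ᴴ *
                (Φᴴ * A)).mulVec (fun i => Ω i j)) ^ 2)
      = (1 / Real.sqrt ((s : ℝ) + 1)) * Real.sqrt (∑ j : Fin (s + 1),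
          euclNorm (fun i => (R * ((Φᴴ * A * Ω)ᴴ * (Φᴴ * A * Ω))⁻¹) i j) ^ 2 /
            ‖((Φᴴ * A * Ω)ᴴ * (Φᴴ * A * Ω))⁻¹ j j‖ ^ 2) := by
  congr 3
  funext j
  have residual_eq : (A - (A * Ω.submatrix id j.succAbove) *
      (((Φᴴ * A * Ω).submatrix id j.succAbove)ᴴ * ((Φᴴ * A * Ω).submatrix id j.succAbove))⁻¹ *
      ((Φᴴ * A * Ω).submatrix id j.succAbove)ᴴ * (Φᴴ * A)).mulVec (fun i => Ω i j) =
      Q *ᵥ ((((Φᴴ * A * Ω)ᴴ * (Φᴴ * A * Ω))⁻¹ j j)⁻¹ •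
        fun i => (R * ((Φᴴ * A * Ω)ᴴ * (Φᴴ * A * Ω))⁻¹) i j) := by
    have col_eq : (fun i => (R * ((Φᴴ * A * Ω)ᴴ * (Φᴴ * A * Ω))⁻¹) i j) =
        R *ᵥ fun i => ((Φᴴ * A * Ω)ᴴ * (Φᴴ * A * Ω))⁻¹ i j := rfl
    have core_col : (fun i => (Φᴴ * A * Ω) i j) = (Φᴴ * A) *ᵥ fun i => Ω i j := rfl
    rw [col_eq, ← mulVec_smul, ← insertNth_leastSquares_eq_smul_inv_col _ j hH (hj j),
      mulVec_mulVec, ← hQR, ← mulVec_mulVec, mulVec_insertNth, core_col, sub_mulVec, one_smul,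
      mulVec_add, mulVec_mulVec, mulVec_mulVec, mulVec_mulVec, sub_eq_add_neg, ← neg_mulVec]
    simp only [Matrix.mul_assoc, Matrix.neg_mul, Matrix.mul_neg]
  rw [residual_eq, sq_euclNorm_mulVec_of_conjTranspose_mul_self Q hQ, sq_euclNorm_smul, norm_inv,
    inv_pow, div_eq_inv_mul]
end
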